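/- arXiv:1803.06264 — 2 statements merged into one kernel-verified Lean document; each statement's English description precedes it below -/
import Mathlib

section
/- Let q, p ∈ ℕ ∪ {∞}, let f be a continuous function which is positive definite on Ω_{2q} × Ω_{2p} with expansion f(ξ,η) = Σ a_{m,n,k,l} R_{m,n}^{q−2}(ξ) R_{k,l}^{p−2}(η), let J = {(m,n,k,l) ∈ ℤ₊⁴ : a_{m,n,k,l} > 0}, and let X = {(z₁,w₁),…,(z_L,w_L)} be a finite set of distinct points in Ω_{2q} × Ω_{2p}. Set A_X = [f(z_μ·z_ν, w_μ·w_ν)]_{μ,ν=1,…,L} and B_X^{m,n,k,l} = [R_{m,n}^{q−2}(z_μ·z_ν) R_{k,l}^{p−2}(w_μ·w_ν)]_{μ,ν=1,…,L}. Then A_X is a positive definite matrix if, and only if, the only vector c ∈ ℂ^L satisfying conj(c)ᵗ B_X^{m,n,k,l} c = 0 for every (m,n,k,l) ∈ J is c = 0. -/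
open scoped ComplexOrder

noncomputable section

/-- The Hilbert space ℓ²(ℂ) of square–summable complex sequences. -/
abbrev Ell2 : Type := lp (fun _ : ℕ => ℂ) 2

/-- The Hermitian inner product of the paper: `hdot z w = z·w = Σ_j z_j conj(w_j)`. -/
def hdot (z w : Ell2) : ℂ := @inner ℂ _ _ w z

/-- The sphere `Ω_{2q}` (for `q : ℕ∞`), viewed inside ℓ²(ℂ): the unit vectors supported
on the first `q` coordinates; for `q = ⊤` this is the unit sphere `Ω_∞` of ℓ²(ℂ). -/
def Omega (q : ℕ∞) : Set Ell2 :=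
  {z | ‖z‖ = 1 ∧ ∀ j : ℕ, q ≤ (j : ℕ∞) → z j = 0}

/-- A kernel `K` is positive definite on a set `S`. -/
def IsPDKernel {α : Type*} (S : Set α) (K : α → α → ℂ) : Prop :=
  ∀ (L : ℕ) (x : Fin L → α), (∀ i, x i ∈ S) → Function.Injective x →
    ∀ c : Fin L → ℂ, 0 ≤ ∑ μ, ∑ ν, c μ * (starRingEnd ℂ) (c ν) * K (x μ) (x ν)

/-- A kernel `K` is strictly positive definite on a set `S`. -/
def IsSPDKernel {α : Type*} (S : Set α) (K : α → α → ℂ) : Prop :=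
  IsPDKernel S K ∧
    ∀ (L : ℕ) (x : Fin L → α), (∀ i, x i ∈ S) → Function.Injective x →
      ∀ c : Fin L → ℂ,
        ∑ μ, ∑ ν, c μ * (starRingEnd ℂ) (c ν) * K (x μ) (x ν) = 0 → c = 0

/-- `f` is positive definite on `Ω_{2q} × Ω_{2p}`. -/
def PDonProd (q p : ℕ∞) (f : ℂ → ℂ → ℂ) : Prop :=
  IsPDKernel ((Omega q) ×ˢ (Omega p))
    (fun x y => f (hdot x.1 y.1) (hdot x.2 y.2))

/-- `f` is strictly positive definite on `Ω_{2q} × Ω_{2p}`. -/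
def SPDonProd (q p : ℕ∞) (f : ℂ → ℂ → ℂ) : Prop :=
  IsSPDKernel ((Omega q) ×ˢ (Omega p))
    (fun x y => f (hdot x.1 y.1) (hdot x.2 y.2))

/-- `g` is positive definite on `Ω_{2q}`. -/
def PDonSphere (q : ℕ∞) (g : ℂ → ℂ) : Prop :=
  IsPDKernel (Omega q) (fun z z' => g (hdot z z'))

/-- The Jacobi polynomial of degree `k` with (integer) parameters `α, β`, normalized
so that its value at `1` is `1`. -/
def jacobiR (α β k : ℕ) (x : ℝ) : ℝ :=
  (∑ s ∈ Finset.range (k + 1),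
      ((k + α).choose (k - s) : ℝ) * ((k + β).choose s : ℝ) *
        ((x - 1) / 2) ^ s * ((x + 1) / 2) ^ (k - s)) /
    ((k + α).choose k : ℝ)

/-- The disc polynomial `R_{m,n}^{q-2}`; for `q = ⊤` (and also `q = 1`) it is
`ξ^m conj(ξ)^n`.  For `2 ≤ q < ⊤` it equals
`r^{|m-n|} e^{i(m-n)φ} R_{min(m,n)}^{(q-2,|m-n|)}(2r²-1)` for `ξ = r e^{iφ}`. -/
def discR (q : ℕ∞) (m n : ℕ) (ξ : ℂ) : ℂ :=
  if q = ⊤ ∨ q ≤ 1 then ξ ^ m * (starRingEnd ℂ ξ) ^ n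
  else (if n ≤ m then ξ ^ (m - n) else (starRingEnd ℂ ξ) ^ (n - m)) *
    ((jacobiR (q.toNat - 2) (max m n - min m n) (min m n)
        (2 * ‖ξ‖ ^ 2 - 1) : ℝ) : ℂ)

/-- The natural domain `𝔻̃`: the unit circle `∂𝔻` when `q = 1` (the sphere `Ω₂`),
the closed unit disc `𝔻` otherwise. -/
def domD (q : ℕ∞) : Set ℂ :=
  if q = 1 then Metric.sphere (0 : ℂ) 1 else Metric.closedBall (0 : ℂ) 1

/-- `A ⊆ ℤ²` intersects every product of full arithmetic progressions in ℤ. -/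
def MeetsAllProgressions (A : Set (ℤ × ℤ)) : Prop :=
  ∀ N M x y : ℤ, 0 < N → 0 < M → 0 < x → 0 < y →
    ∃ v ∈ A, (∃ j : ℤ, v.1 = N * j + x) ∧ (∃ j : ℤ, v.2 = M * j + y)

open MvPolynomial Finset in
/-- The Fischer pairing, the bilinear form with `⟨X^α, X^β⟩ = α!` if `α = β` and `0` otherwise. -/
def fischer (σ : Type*) [Fintype σ] :
    MvPolynomial σ ℂ →ₗ[ℂ] MvPolynomial σ ℂ →ₗ[ℂ] ℂ :=
  (basisMonomials σ ℂ).constr ℂ fun α => ((∏ i, (α i).factorial : ℕ) : ℂ) • lcoeff ℂ α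

namespace fischer

open MvPolynomial Finset

section Pairing

variable {σ : Type*} [Fintype σ]

lemma monomial_left (α : σ →₀ ℕ) (c : ℂ) (Q : MvPolynomial σ ℂ) :
    fischer σ (monomial α c) Q = c * (((∏ i, (α i).factorial : ℕ) : ℂ) * coeff α Q) := by
  have h : monomial α c = c • basisMonomials σ ℂ α := by
    simp [coe_basisMonomials, smul_monomial]
  rw [h, map_smul, fischer, Module.Basis.constr_basis]
  simp [lcoeff_apply]

lemma X_mul_left [DecidableEq σ] (i : σ) (P Q : MvPolynomial σ ℂ) :
    fischer σ (X i * P) Q = fischer σ P (pderiv i Q) := by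
  induction P using MvPolynomial.induction_on' with
  | add p q hp hq => simp [mul_add, hp, hq]
  | monomial α c =>
    rw [X, monomial_mul, one_mul, monomial_left, monomial_left, coeff_pderiv]
    have h : (∏ j, ((Finsupp.single i 1 + α : σ →₀ ℕ) j).factorial) =
        (α i + 1) * ∏ j, (α j).factorial := by
      rw [← mul_prod_erase univ _ (mem_univ i), ← mul_prod_erase univ _ (mem_univ i), ← mul_assoc]
      congr 1
      · simp [add_comm 1, Nat.factorial_succ]
      · refine prod_congr rfl fun j hj => ?_
        simp [(ne_of_mem_erase hj).symm]
    rw [h, add_comm (Finsupp.single i 1)]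
    push_cast
    ring

lemma symm (P Q : MvPolynomial σ ℂ) : fischer σ P Q = fischer σ Q P := by
  classical
  induction P using MvPolynomial.induction_on' with
  | add p q hp hq => simp [hp, hq]
  | monomial α c =>
    induction Q using MvPolynomial.induction_on' with
    | add p q hp hq => simp [hp, hq]
    | monomial β d =>
      rw [monomial_left, monomial_left, coeff_monomial, coeff_monomial]
      rcases eq_or_ne α β with rfl | h
      · simp only [if_true]
        ring
      · simp [h, h.symm]

lemma conj_nonneg (P : MvPolynomial σ ℂ) :
    0 ≤ fischer σ P (map (starRingEnd ℂ) P) := by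
  have h : fischer σ P (map (starRingEnd ℂ) P) = ∑ α ∈ P.support,
      ((∏ i, (α i).factorial : ℕ) : ℂ) * (coeff α P * starRingEnd ℂ (coeff α P)) := by
    conv_lhs => enter [1, 2]; rw [P.as_sum]
    simp only [map_sum, LinearMap.sum_apply, monomial_left, coeff_map]
    exact sum_congr rfl fun α _ => by ring
  rw [h]
  exact sum_nonneg fun α _ => mul_nonneg (Nat.cast_nonneg _) (mul_star_self_nonneg _)

end Pairing

section Laplacian

variable {ι : Type*} [Fintype ι]

/-- The holomorphic linear form `∑ a_j x_j`. -/
def linX (a : ι → ℂ) : MvPolynomial (ι ⊕ ι) ℂ := ∑ j, C (a j) * X (Sum.inl j)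

/-- The antiholomorphic linear form `∑ b_j y_j`. -/
def linY (b : ι → ℂ) : MvPolynomial (ι ⊕ ι) ℂ := ∑ j, C (b j) * X (Sum.inr j)

variable (ι) in
/-- The squared norm `∑ x_j y_j`. -/
def normSq : MvPolynomial (ι ⊕ ι) ℂ := ∑ j, X (Sum.inl j) * X (Sum.inr j)

/-- The polarized form of `|z·w|² - |z|²`. -/
def defect (a b : ι → ℂ) : MvPolynomial (ι ⊕ ι) ℂ := linX a * linY b - normSq ι

variable (ι) in
/-- The Laplacian `∑ ∂/∂x_j ∂/∂y_j`. -/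
def lap : MvPolynomial (ι ⊕ ι) ℂ →ₗ[ℂ] MvPolynomial (ι ⊕ ι) ℂ :=
  ∑ j, (pderiv (Sum.inl j)).toLinearMap ∘ₗ (pderiv (Sum.inr j)).toLinearMap

lemma lap_apply (P : MvPolynomial (ι ⊕ ι) ℂ) :
    lap ι P = ∑ j, pderiv (Sum.inl j) (pderiv (Sum.inr j) P) := by
  simp [lap]

/-- The carré du champ of the Laplacian, as a derivation in its second argument. -/
def gam (P : MvPolynomial (ι ⊕ ι) ℂ) :
    Derivation ℂ (MvPolynomial (ι ⊕ ι) ℂ) (MvPolynomial (ι ⊕ ι) ℂ) :=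
  ∑ j, (pderiv (Sum.inl j) P • pderiv (Sum.inr j) + pderiv (Sum.inr j) P • pderiv (Sum.inl j))

lemma gam_apply (P Q : MvPolynomial (ι ⊕ ι) ℂ) :
    gam P Q = ∑ j, (pderiv (Sum.inl j) P * pderiv (Sum.inr j) Q +
      pderiv (Sum.inr j) P * pderiv (Sum.inl j) Q) := by
  rw [gam, ← Derivation.coeFnAddMonoidHom_apply, map_sum, Finset.sum_apply]
  simp

lemma gam_comm (P Q : MvPolynomial (ι ⊕ ι) ℂ) : gam P Q = gam Q P := by
  simp only [gam_apply]
  exact sum_congr rfl fun j _ => by ring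

lemma lap_mul (P Q : MvPolynomial (ι ⊕ ι) ℂ) :
    lap ι (P * Q) = P * lap ι Q + Q * lap ι P + gam P Q := by
  simp only [lap_apply, gam_apply, mul_sum, ← sum_add_distrib]
  refine sum_congr rfl fun j _ => ?_
  simp only [Derivation.leibniz, smul_eq_mul, map_add]
  ring

lemma sum_C_mul (a b : ι → ℂ) (h : ∑ j, a j * b j = 1) :
    ∑ j, (C (a j) * C (b j) : MvPolynomial (ι ⊕ ι) ℂ) = 1 := by
  simp only [← C_mul, ← map_sum, h, C_1]

variable [DecidableEq ι]

lemma pderiv_inl_linX (a : ι → ℂ) (j : ι) : pderiv (Sum.inl j) (linX a) = C (a j) := by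
  simp [linX, pderiv_X, Pi.single_apply]

lemma pderiv_inr_linX (a : ι → ℂ) (j : ι) : pderiv (Sum.inr j) (linX a) = 0 := by
  simp [linX, pderiv_X]

lemma pderiv_inl_linY (a : ι → ℂ) (j : ι) : pderiv (Sum.inl j) (linY a) = 0 := by
  simp [linY, pderiv_X]

lemma pderiv_inr_linY (a : ι → ℂ) (j : ι) : pderiv (Sum.inr j) (linY a) = C (a j) := by
  simp [linY, pderiv_X, Pi.single_apply]

lemma pderiv_inl_normSq (j : ι) : pderiv (Sum.inl j) (normSq ι) = X (Sum.inr j) := by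
  simp [normSq, pderiv_X, Pi.single_apply]

lemma pderiv_inr_normSq (j : ι) : pderiv (Sum.inr j) (normSq ι) = X (Sum.inl j) := by
  simp [normSq, pderiv_X, Pi.single_apply]

lemma pderiv_inl_defect (a b : ι → ℂ) (j : ι) :
    pderiv (Sum.inl j) (defect a b) = C (a j) * linY b - X (Sum.inr j) := by
  simp [defect, pderiv_inl_linX, pderiv_inl_linY, pderiv_inl_normSq, mul_comm]

lemma pderiv_inr_defect (a b : ι → ℂ) (j : ι) :
    pderiv (Sum.inr j) (defect a b) = C (b j) * linX a - X (Sum.inl j) := by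
  simp [defect, pderiv_inr_linX, pderiv_inr_linY, pderiv_inr_normSq, mul_comm]

lemma gam_linX_linY (a b : ι → ℂ) (h : ∑ j, a j * b j = 1) : gam (linX a) (linY b) = 1 := by
  simp [gam_apply, pderiv_inl_linX, pderiv_inr_linX, pderiv_inr_linY, sum_C_mul a b h]

lemma gam_defect_linX (a b : ι → ℂ) (h : ∑ j, a j * b j = 1) :
    gam (defect a b) (linX a) = 0 := by
  simp only [gam_apply, pderiv_inl_linX, pderiv_inr_linX, pderiv_inr_defect, mul_zero, zero_add]
  have : ∀ j, (C (b j) * linX a - X (Sum.inl j)) * C (a j) =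
      C (a j) * C (b j) * linX a - C (a j) * X (Sum.inl j) := fun j => by ring
  simp only [this, sum_sub_distrib, ← sum_mul, sum_C_mul a b h]
  simp [linX]

lemma gam_defect_linY (a b : ι → ℂ) (h : ∑ j, a j * b j = 1) :
    gam (defect a b) (linY b) = 0 := by
  simp only [gam_apply, pderiv_inl_linY, pderiv_inr_linY, pderiv_inl_defect, mul_zero, add_zero]
  have : ∀ j, (C (a j) * linY b - X (Sum.inr j)) * C (b j) =
      C (a j) * C (b j) * linY b - C (b j) * X (Sum.inr j) := fun j => by ring
  simp only [this, sum_sub_distrib, ← sum_mul, sum_C_mul a b h]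
  simp [linY]

lemma gam_defect_defect (a b : ι → ℂ) (h : ∑ j, a j * b j = 1) :
    gam (defect a b) (defect a b) = -2 * defect a b := by
  simp only [gam_apply, pderiv_inl_defect, pderiv_inr_defect]
  have : ∀ j, ((C (a j) * linY b - X (Sum.inr j)) * (C (b j) * linX a - X (Sum.inl j)) +
      (C (b j) * linX a - X (Sum.inl j)) * (C (a j) * linY b - X (Sum.inr j)) :
        MvPolynomial (ι ⊕ ι) ℂ) =
      2 * (C (a j) * C (b j) * (linX a * linY b) - C (a j) * X (Sum.inl j) * linY b
        - C (b j) * X (Sum.inr j) * linX a + X (Sum.inl j) * X (Sum.inr j)) := fun j => by ring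
  simp only [this, sum_sub_distrib, sum_add_distrib, ← mul_sum, ← sum_mul, sum_C_mul a b h]
  rw [← linX, ← linY, ← normSq, defect]
  ring

lemma lap_linX_pow (a : ι → ℂ) (n : ℕ) : lap ι (linX a ^ n) = 0 := by
  simp [lap_apply, Derivation.leibniz_pow, pderiv_inr_linX]

lemma lap_linY_pow (b : ι → ℂ) (n : ℕ) : lap ι (linY b ^ n) = 0 := by
  simp [lap_apply, Derivation.leibniz_pow, pderiv_inr_linY, pderiv_inl_linY]

lemma lap_defect (a b : ι → ℂ) (h : ∑ j, a j * b j = 1) :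
    lap ι (defect a b) = 1 - (Fintype.card ι : MvPolynomial (ι ⊕ ι) ℂ) := by
  simp only [lap_apply, pderiv_inr_defect]
  simp [pderiv_inl_linX, sum_sub_distrib, pderiv_X, mul_comm (C (b _)), sum_C_mul a b h]

lemma lap_defect_pow (a b : ι → ℂ) (h : ∑ j, a j * b j = 1) (s : ℕ) :
    lap ι (defect a b ^ (s + 1)) =
      -((s + 1) * (s + Fintype.card ι - 1)) * defect a b ^ s := by
  induction s with
  | zero => simp [lap_defect a b h]
  | succ s ih =>
    rw [pow_succ', lap_mul, ih, lap_defect a b h, Derivation.leibniz_pow, gam_defect_defect a b h]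
    simp only [nsmul_eq_mul, smul_eq_mul, Nat.add_sub_cancel]
    push_cast
    ring

lemma lap_linX_pow_mul_linY_pow (a b : ι → ℂ) (h : ∑ j, a j * b j = 1) (m n : ℕ) :
    lap ι (linX a ^ m * linY b ^ n) = m * n * (linX a ^ (m - 1) * linY b ^ (n - 1)) := by
  rw [lap_mul, lap_linX_pow, lap_linY_pow, Derivation.leibniz_pow, gam_comm,
    Derivation.leibniz_pow, gam_comm, gam_linX_linY a b h]
  simp only [nsmul_eq_mul, smul_eq_mul]
  ring

lemma lap_defect_pow_mul (a b : ι → ℂ) (h : ∑ j, a j * b j = 1) (s m n : ℕ) :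
    lap ι (defect a b ^ s * (linX a ^ m * linY b ^ n)) =
      linX a ^ m * linY b ^ n * lap ι (defect a b ^ s) +
        m * n * (defect a b ^ s * (linX a ^ (m - 1) * linY b ^ (n - 1))) := by
  have hg : gam (defect a b ^ s) (linX a ^ m * linY b ^ n) = 0 := by
    rw [gam_comm, Derivation.leibniz_pow, gam_comm, Derivation.leibniz, Derivation.leibniz_pow,
      Derivation.leibniz_pow, gam_defect_linX a b h, gam_defect_linY a b h]
    simp
  rw [lap_mul, lap_linX_pow_mul_linY_pow a b h, hg]
  ring

end Laplacian

section Zonal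

variable {ι : Type*} [Fintype ι]

/-- The coefficients of the Jacobi polynomial in powers of `(x - 1) / 2` and `(x + 1) / 2`. -/
def jacobiCoeff (α β k s : ℕ) : ℕ := (k + α).choose (k - s) * (k + β).choose s

lemma jacobiCoeff_succ (α β k s : ℕ) (hs : s < k) :
    jacobiCoeff α β k (s + 1) * ((s + 1) * (s + 1 + α)) =
      jacobiCoeff α β k s * ((k - s + β) * (k - s)) := by
  obtain ⟨r, rfl⟩ : ∃ r, k = s + 1 + r := ⟨k - s - 1, by omega⟩
  have h1 := Nat.choose_succ_right_eq (s + 1 + r + α) r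
  have h2 := Nat.choose_succ_right_eq (s + 1 + r + β) s
  have e1 : s + 1 + r - (s + 1) = r := by omega
  have e2 : s + 1 + r - s = r + 1 := by omega
  have e3 : s + 1 + r + α - r = s + 1 + α := by omega
  have e4 : s + 1 + r + β - s = r + 1 + β := by omega
  rw [e3] at h1
  rw [e4] at h2
  simp only [jacobiCoeff, e1, e2]
  calc _ = ((s + 1 + r + α).choose r * (s + 1 + α)) *
        ((s + 1 + r + β).choose (s + 1) * (s + 1)) := by ring
    _ = _ := by rw [← h1, h2]; ring

/-- The zonal harmonic polynomial of bidegree `(k + β, k)` with pole `(a, b)`. -/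
def zonal (α β k : ℕ) (a b : ι → ℂ) : MvPolynomial (ι ⊕ ι) ℂ :=
  ∑ s ∈ range (k + 1), (jacobiCoeff α β k s : MvPolynomial (ι ⊕ ι) ℂ) *
    (defect a b ^ s * (linX a ^ (k - s + β) * linY b ^ (k - s)))

lemma lap_natCast_mul [DecidableEq ι] (n : ℕ) (P : MvPolynomial (ι ⊕ ι) ℂ) :
    lap ι (n * P) = n * lap ι P := by
  rw [← nsmul_eq_mul, map_nsmul, nsmul_eq_mul]

lemma lap_zonal [DecidableEq ι] (α β k : ℕ) (a b : ι → ℂ) (h : ∑ j, a j * b j = 1)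
    (hα : Fintype.card ι = α + 2) : lap ι (zonal α β k a b) = 0 := by
  simp only [zonal, map_sum, lap_natCast_mul, lap_defect_pow_mul a b h, mul_add, sum_add_distrib]
  rw [sum_range_succ', sum_range_succ _ k]
  have h0 : lap ι (defect a b ^ 0) = 0 := by simp [lap_apply]
  simp only [h0, mul_zero, add_zero, Nat.sub_self, Nat.cast_zero, zero_mul, ← sum_add_distrib]
  refine sum_eq_zero fun s hs => ?_
  have hs : s < k := mem_range.1 hs
  have hc := congrArg (Nat.cast : ℕ → MvPolynomial (ι ⊕ ι) ℂ) (jacobiCoeff_succ α β k s hs)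
  rw [lap_defect_pow a b h, hα]
  have e1 : k - (s + 1) = k - s - 1 := by omega
  have e2 : k - s + β - 1 = k - s - 1 + β := by omega
  rw [e1, e2]
  push_cast at hc ⊢
  linear_combination (-(defect a b ^ s * (linX a ^ (k - s - 1 + β) * linY b ^ (k - s - 1)))) * hc

lemma normSq_dvd_zonal_sub (α β k : ℕ) (a b : ι → ℂ) :
    normSq ι ∣ zonal α β k a b - ((∑ s ∈ range (k + 1), jacobiCoeff α β k s : ℕ) :
      MvPolynomial (ι ⊕ ι) ℂ) * (linX a ^ (k + β) * linY b ^ k) := by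
  rw [zonal, Nat.cast_sum, sum_mul, ← sum_sub_distrib]
  refine dvd_sum fun s hs => ?_
  have hs : s ≤ k := Nat.lt_succ_iff.1 (mem_range.1 hs)
  have e : linX a ^ (k + β) * linY b ^ k =
      (linX a * linY b) ^ s * (linX a ^ (k - s + β) * linY b ^ (k - s)) := by
    rw [mul_pow, mul_mul_mul_comm, ← pow_add, ← pow_add]
    congr 2 <;> omega
  rw [e, ← mul_sub, ← sub_mul]
  refine Dvd.dvd.mul_left (Dvd.dvd.mul_right ?_ _) _
  refine dvd_trans ⟨-1, ?_⟩ (sub_dvd_pow_sub_pow (defect a b) (linX a * linY b) s)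
  rw [defect]
  ring

lemma map_zonal (α β k : ℕ) (a b : ι → ℂ) :
    map (starRingEnd ℂ) (zonal α β k a b) =
      zonal α β k (fun j => starRingEnd ℂ (a j)) (fun j => starRingEnd ℂ (b j)) := by
  simp [zonal, defect, linX, linY, normSq]

variable [DecidableEq ι]

lemma linX_mul_left (a : ι → ℂ) (P Q : MvPolynomial (ι ⊕ ι) ℂ) :
    fischer _ (linX a * P) Q = ∑ j, a j * fischer _ P (pderiv (Sum.inl j) Q) := by
  simp only [linX, sum_mul, map_sum, LinearMap.sum_apply, C_mul', smul_mul_assoc,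
    map_smul, LinearMap.smul_apply, X_mul_left, smul_eq_mul]

lemma linY_mul_left (b : ι → ℂ) (P Q : MvPolynomial (ι ⊕ ι) ℂ) :
    fischer _ (linY b * P) Q = ∑ j, b j * fischer _ P (pderiv (Sum.inr j) Q) := by
  simp only [linY, sum_mul, map_sum, LinearMap.sum_apply, C_mul', smul_mul_assoc,
    map_smul, LinearMap.smul_apply, X_mul_left, smul_eq_mul]

lemma normSq_mul_left (P Q : MvPolynomial (ι ⊕ ι) ℂ) :
    fischer _ (normSq ι * P) Q = fischer _ P (lap ι Q) := by
  simp only [normSq, sum_mul, map_sum, LinearMap.sum_apply, lap_apply, mul_assoc, X_mul_left]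
  refine sum_congr rfl fun j _ => ?_
  rw [← X_mul_left, ← X_mul_left, ← X_mul_left, ← X_mul_left]
  congr 2
  ring

lemma normSq_mul_right (P Q : MvPolynomial (ι ⊕ ι) ℂ) :
    fischer _ P (normSq ι * Q) = fischer _ (lap ι P) Q := by
  rw [symm, normSq_mul_left, symm]

lemma linX_mul_left_pow (a a' b' : ι → ℂ) (P : MvPolynomial (ι ⊕ ι) ℂ) (m n : ℕ) :
    fischer _ (linX a * P) (linX a' ^ (m + 1) * linY b' ^ n) =
      (m + 1) * (∑ j, a j * a' j) * fischer _ P (linX a' ^ m * linY b' ^ n) := by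
  have hd (j : ι) : pderiv (Sum.inl j) (linX a' ^ (m + 1) * linY b' ^ n) =
      ((m + 1) * a' j : ℂ) • (linX a' ^ m * linY b' ^ n) := by
    simp only [Derivation.leibniz, Derivation.leibniz_pow, pderiv_inl_linX, pderiv_inl_linY,
      smul_eq_C_mul, smul_eq_mul, nsmul_eq_mul, Nat.add_sub_cancel, C_mul, C_add, C_1, map_natCast]
    push_cast
    ring
  simp only [linX_mul_left, hd, map_smul, smul_eq_mul, mul_sum, sum_mul]
  exact sum_congr rfl fun j _ => by ring

lemma linY_mul_left_pow (b a' b' : ι → ℂ) (P : MvPolynomial (ι ⊕ ι) ℂ) (m n : ℕ) :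
    fischer _ (linY b * P) (linX a' ^ m * linY b' ^ (n + 1)) =
      (n + 1) * (∑ j, b j * b' j) * fischer _ P (linX a' ^ m * linY b' ^ n) := by
  have hd (j : ι) : pderiv (Sum.inr j) (linX a' ^ m * linY b' ^ (n + 1)) =
      ((n + 1) * b' j : ℂ) • (linX a' ^ m * linY b' ^ n) := by
    simp only [Derivation.leibniz, Derivation.leibniz_pow, pderiv_inr_linX, pderiv_inr_linY,
      smul_eq_C_mul, smul_eq_mul, nsmul_eq_mul, Nat.add_sub_cancel, C_mul, C_add, C_1, map_natCast]
    push_cast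
    ring
  simp only [linY_mul_left, hd, map_smul, smul_eq_mul, mul_sum, sum_mul]
  exact sum_congr rfl fun j _ => by ring

lemma defect_mul_left_pow (a b a' b' : ι → ℂ) (h' : ∑ j, a' j * b' j = 1)
    (P : MvPolynomial (ι ⊕ ι) ℂ) (m n : ℕ) :
    fischer _ (defect a b * P) (linX a' ^ (m + 1) * linY b' ^ (n + 1)) =
      (m + 1) * (n + 1) * ((∑ j, a j * a' j) * (∑ j, b j * b' j) - 1) *
        fischer _ P (linX a' ^ m * linY b' ^ n) := by
  have hl : lap ι (linX a' ^ (m + 1) * linY b' ^ (n + 1)) =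
      ((m + 1) * (n + 1) : ℂ) • (linX a' ^ m * linY b' ^ n) := by
    rw [lap_linX_pow_mul_linY_pow a' b' h']
    simp [smul_eq_C_mul]
  rw [defect, sub_mul, map_sub, LinearMap.sub_apply, mul_assoc, linX_mul_left_pow,
    linY_mul_left_pow, normSq_mul_left, hl, map_smul, smul_eq_mul]
  ring

lemma defect_pow_mul_left (a b a' b' : ι → ℂ) (h' : ∑ j, a' j * b' j = 1) (s m n : ℕ) :
    fischer _ (defect a b ^ s * (linX a ^ m * linY b ^ n))
        (linX a' ^ (m + s) * linY b' ^ (n + s)) =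
      (m + s).factorial * (n + s).factorial *
        (((∑ j, a j * a' j) * (∑ j, b j * b' j) - 1) ^ s *
          ((∑ j, a j * a' j) ^ m * (∑ j, b j * b' j) ^ n)) := by
  induction s with
  | zero =>
    simp only [pow_zero, one_mul, add_zero]
    induction m with
    | zero =>
      induction n with
      | zero =>
        have := monomial_left (σ := ι ⊕ ι) 0 1 1
        simpa using this
      | succ n ih =>
        simp only [pow_zero, one_mul] at ih
        have := linY_mul_left_pow b a' b' (linY b ^ n) 0 n
        simp only [pow_zero, one_mul] at this
        rw [pow_zero, one_mul, pow_zero, one_mul, pow_succ' (linY b), this, ih, Nat.factorial_succ]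
        push_cast
        ring
    | succ m ih =>
      rw [pow_succ' (linX a), mul_assoc, linX_mul_left_pow, ih, Nat.factorial_succ]
      push_cast
      ring
  | succ s ih =>
    rw [pow_succ', mul_assoc, ← add_assoc, ← add_assoc, defect_mul_left_pow a b a' b' h', ih,
      Nat.factorial_succ, Nat.factorial_succ]
    push_cast
    ring

/-- The value of the zonal polynomials, up to normalization. -/
def zonalValue (α β k : ℕ) (t t' : ℂ) : ℂ :=
  ∑ s ∈ range (k + 1), (jacobiCoeff α β k s : ℂ) *
    ((t * t' - 1) ^ s * (t ^ (k - s + β) * t' ^ (k - s)))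

lemma natCast_mul_left {σ : Type*} [Fintype σ] (c : ℕ) (P Q : MvPolynomial σ ℂ) :
    fischer σ (c * P) Q = c * fischer σ P Q := by
  rw [← nsmul_eq_mul, map_nsmul, LinearMap.smul_apply, nsmul_eq_mul]

lemma zonal_left (α β k : ℕ) (a b a' b' : ι → ℂ) (h' : ∑ j, a' j * b' j = 1) :
    fischer _ (zonal α β k a b) (linX a' ^ (k + β) * linY b' ^ k) =
      (k + β).factorial * k.factorial *
        zonalValue α β k (∑ j, a j * a' j) (∑ j, b j * b' j) := by
  simp only [zonal, zonalValue, map_sum, LinearMap.sum_apply, natCast_mul_left]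
  rw [mul_sum]
  refine sum_congr rfl fun s hs => ?_
  have hs : s ≤ k := Nat.lt_succ_iff.1 (mem_range.1 hs)
  have := defect_pow_mul_left a b a' b' h' s (k - s + β) (k - s)
  rw [show k - s + β + s = k + β by omega, Nat.sub_add_cancel hs] at this
  rw [this]
  ring

lemma zonal_zonal (α β k : ℕ) (a b a' b' : ι → ℂ) (h : ∑ j, a j * b j = 1)
    (h' : ∑ j, a' j * b' j = 1) (hα : Fintype.card ι = α + 2) :
    fischer _ (zonal α β k a b) (zonal α β k a' b') =
      ((∑ s ∈ range (k + 1), jacobiCoeff α β k s) * (k + β).factorial * k.factorial : ℕ) *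
        zonalValue α β k (∑ j, a j * a' j) (∑ j, b j * b' j) := by
  obtain ⟨Q, hQ⟩ := normSq_dvd_zonal_sub α β k a' b'
  rw [sub_eq_iff_eq_add] at hQ
  rw [hQ, map_add, normSq_mul_right, lap_zonal α β k a b h hα, symm _ (_ * _), natCast_mul_left,
    symm _ (zonal α β k a b), zonal_left α β k a b a' b' h']
  push_cast
  simp only [map_zero, LinearMap.zero_apply, zero_add]
  ring

lemma zonalValue_nonneg (α β k : ℕ) (hα : Fintype.card ι = α + 2) {L : ℕ} (z : Fin L → ι → ℂ)
    (hz : ∀ μ, ∑ j, z μ j * starRingEnd ℂ (z μ j) = 1) (c : Fin L → ℂ) :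
    0 ≤ ∑ μ, ∑ ν, starRingEnd ℂ (c μ) * c ν *
      zonalValue α β k (∑ j, z μ j * starRingEnd ℂ (z ν j))
        (∑ j, starRingEnd ℂ (z μ j) * z ν j) := by
  set N : ℕ := (∑ s ∈ range (k + 1), jacobiCoeff α β k s) * (k + β).factorial * k.factorial
  have hN : (0 : ℂ) < N := by
    have : 0 < ∑ s ∈ range (k + 1), jacobiCoeff α β k s := by
      refine sum_pos' (fun _ _ => Nat.zero_le _) ⟨0, by simp, ?_⟩
      simpa [jacobiCoeff] using Nat.choose_pos (by omega)
    exact_mod_cast Nat.mul_pos (Nat.mul_pos this (Nat.factorial_pos _)) (Nat.factorial_pos _)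
  have hP := conj_nonneg (∑ ν, c ν • zonal α β k (fun j => starRingEnd ℂ (z ν j)) (z ν))
  have hz' (μ : Fin L) : ∑ j, starRingEnd ℂ (z μ j) * z μ j = 1 := by
    simpa only [mul_comm] using hz μ
  have hmap (μ : Fin L) : map (starRingEnd ℂ)
      (c μ • zonal α β k (fun j => starRingEnd ℂ (z μ j)) (z μ)) =
      starRingEnd ℂ (c μ) • zonal α β k (z μ) (fun j => starRingEnd ℂ (z μ j)) := by
    rw [smul_eq_C_mul, map_mul, map_C, map_zonal, smul_eq_C_mul]
    simp
  simp only [map_sum, hmap, LinearMap.sum_apply, map_smul, LinearMap.smul_apply,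
    zonal_zonal α β k _ _ _ _ (hz' _) (hz _) hα] at hP
  have hfac : (∑ μ, ∑ ν, starRingEnd ℂ (c μ) * c ν *
      zonalValue α β k (∑ j, z μ j * starRingEnd ℂ (z ν j))
        (∑ j, starRingEnd ℂ (z μ j) * z ν j)) * (N : ℂ) =
      ∑ μ, starRingEnd ℂ (c μ) • ∑ ν, c ν • ((N : ℂ) *
        zonalValue α β k (∑ j, starRingEnd ℂ (z ν j) * z μ j)
          (∑ j, z ν j * starRingEnd ℂ (z μ j))) := by
    simp only [sum_mul, smul_eq_mul, mul_sum]
    refine sum_congr rfl fun μ _ => sum_congr rfl fun ν _ => ?_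
    simp only [mul_comm (z _ _)]
    ring
  refine le_of_mul_le_mul_of_pos_right ?_ hN
  rw [hfac, zero_mul]
  exact hP

end Zonal

end fischer

lemma jacobiR_one (α β k : ℕ) : jacobiR α β k 1 = 1 := by
  have hc : ((k + α).choose k : ℝ) ≠ 0 := by exact_mod_cast (Nat.choose_pos (by omega)).ne'
  rw [jacobiR, Finset.sum_eq_single 0]
  · simp [hc]
  · intro s _ hs
    simp [hs]
  · simp

lemma discR_one (q : ℕ∞) (m n : ℕ) : discR q m n 1 = 1 := by
  have h : (2 * ‖(1 : ℂ)‖ ^ 2 - 1 : ℝ) = 1 := by norm_num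
  rw [discR, h, jacobiR_one]
  simp

lemma conj_discR (q : ℕ∞) (m n : ℕ) (ξ : ℂ) :
    starRingEnd ℂ (discR q m n ξ) = discR q m n (starRingEnd ℂ ξ) := by
  simp only [discR, Complex.norm_conj]
  split_ifs <;> simp

lemma discR_swap (q : ℕ∞) (m n : ℕ) (ξ : ℂ) :
    discR q m n ξ = discR q n m (starRingEnd ℂ ξ) := by
  simp only [discR, Complex.norm_conj, max_comm m n, min_comm m n, Complex.conj_conj]
  rcases lt_trichotomy m n with h | rfl | h
  · simp [h.le, h.not_ge, mul_comm]
  · simp [mul_comm]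
  · simp [h.le, h.not_ge, mul_comm]

lemma discR_eq_zonalValue (α β k : ℕ) (ξ : ℂ) :
    discR ((α + 2 : ℕ) : ℕ∞) (k + β) k ξ =
      (((k + α).choose k : ℝ)⁻¹ : ℝ) * fischer.zonalValue α β k ξ (starRingEnd ℂ ξ) := by
  have h1 : ¬ (((α + 2 : ℕ) : ℕ∞) = ⊤ ∨ ((α + 2 : ℕ) : ℕ∞) ≤ 1) := by
    rintro (h | h)
    · exact ENat.natCast_ne_top _ h
    · have : α + 2 ≤ 1 := by exact_mod_cast h
      omega
  have e1 : (2 * ‖ξ‖ ^ 2 - 1 - 1) / 2 = ‖ξ‖ ^ 2 - 1 := by ring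
  have e2 : (2 * ‖ξ‖ ^ 2 - 1 + 1) / 2 = ‖ξ‖ ^ 2 := by ring
  have hn : ((‖ξ‖ : ℂ)) ^ 2 = ξ * starRingEnd ℂ ξ := (Complex.mul_conj' ξ).symm
  rw [discR, if_neg h1, if_pos (Nat.le_add_right k β), ENat.toNat_natCast,
    max_eq_left (Nat.le_add_right k β), min_eq_right (Nat.le_add_right k β),
    Nat.add_sub_cancel, Nat.add_sub_cancel_left, jacobiR, e1, e2, fischer.zonalValue, div_eq_inv_mul]
  push_cast
  rw [hn, mul_left_comm, Finset.mul_sum]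
  congr 1
  refine Finset.sum_congr rfl fun s _ => ?_
  rw [fischer.jacobiCoeff, mul_pow ξ, pow_add]
  push_cast
  ring

lemma conj_hdot (z w : Ell2) : starRingEnd ℂ (hdot z w) = hdot w z :=
  inner_conj_symm z w

lemma hdot_self_of_mem_Omega {q : ℕ∞} {z : Ell2} (hz : z ∈ Omega q) : hdot z z = 1 := by
  rw [hdot, inner_self_eq_norm_sq_to_K, hz.1]
  simp

lemma hdot_eq_sum {Q : ℕ} {z w : Ell2} (hz : z ∈ Omega (Q : ℕ∞)) :
    hdot z w = ∑ j : Fin Q, z j * starRingEnd ℂ (w j) := by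
  rw [hdot, lp.inner_eq_tsum, tsum_eq_sum (s := Finset.range Q)]
  · rw [Finset.sum_range]
    simp
  · intro j hj
    have : z j = 0 := hz.2 j (by exact_mod_cast (not_lt.1 (by simpa using hj)))
    simp [this]

lemma hdot_mem_domD {q : ℕ∞} {z w : Ell2} (hz : z ∈ Omega q) (hw : w ∈ Omega q) :
    hdot z w ∈ domD q := by
  rw [domD]
  split_ifs with h
  · subst h
    have hz' := hdot_self_of_mem_Omega hz
    have hw' := hdot_self_of_mem_Omega hw
    rw [← Nat.cast_one] at hz hw
    rw [hdot_eq_sum hz] at hz' ⊢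
    rw [hdot_eq_sum hw] at hw'
    have hz2 := congrArg norm hz'
    have hw2 := congrArg norm hw'
    simp only [Fin.sum_univ_one, norm_mul, Complex.norm_conj, norm_one, ← sq] at hz2 hw2
    rw [pow_eq_one_iff_of_nonneg (norm_nonneg _) two_ne_zero] at hz2 hw2
    rw [mem_sphere_zero_iff_norm, Fin.sum_univ_one, norm_mul, Complex.norm_conj, hz2, hw2, mul_one]
  · rw [mem_closedBall_zero_iff, hdot]
    simpa [hz.1, hw.1] using norm_inner_le_norm (𝕜 := ℂ) w z

open Matrix in
lemma posSemidef_hdot {L : ℕ} (z : Fin L → Ell2) :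
    (Matrix.of fun μ ν => hdot (z μ) (z ν)).PosSemidef :=
  (posSemidef_gram ℂ z).transpose

lemma posSemidef_of_pow {L : ℕ} {M : Matrix (Fin L) (Fin L) ℂ} (hM : M.PosSemidef) (n : ℕ) :
    (Matrix.of fun μ ν => M μ ν ^ n).PosSemidef := by
  induction n with
  | zero =>
    convert Matrix.posSemidef_vecMulVec_self_star (fun _ : Fin L => (1 : ℂ)) using 1
    ext
    simp [Matrix.vecMulVec_apply]
  | succ n ih =>
    have h : (Matrix.of fun μ ν => M μ ν ^ (n + 1)) =
        (Matrix.of fun μ ν => M μ ν ^ n).hadamard M := by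
      ext
      simp [pow_succ]
    rw [h]
    exact ih.hadamard hM

lemma posSemidef_zonal {Q α : ℕ} (hQ : Q = α + 2) (β k : ℕ) {L : ℕ} (z : Fin L → Ell2)
    (hz : ∀ μ, z μ ∈ Omega (Q : ℕ∞)) :
    (Matrix.of fun μ ν => discR (Q : ℕ∞) (k + β) k (hdot (z μ) (z ν))).PosSemidef := by
  refine .of_dotProduct_mulVec_nonneg ?_ fun c => ?_
  · ext μ ν
    simp [conj_discR, conj_hdot]
  · subst hQ
    have h := fischer.zonalValue_nonneg α β k (Fintype.card_fin (α + 2)) (fun μ j => z μ j)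
      (fun μ => by rw [← hdot_eq_sum (hz μ), hdot_self_of_mem_Omega (hz μ)]) c
    have hC : (0 : ℂ) ≤ (((k + α).choose k : ℝ)⁻¹ : ℝ) := by
      rw [Complex.zero_le_real]
      positivity
    convert mul_nonneg hC h using 1
    simp only [dotProduct, Matrix.mulVec, Matrix.of_apply, Pi.star_apply, Finset.mul_sum,
      RCLike.star_def]
    refine Finset.sum_congr rfl fun μ _ => Finset.sum_congr rfl fun ν _ => ?_
    rw [discR_eq_zonalValue, conj_hdot, hdot_eq_sum (hz μ), hdot_eq_sum (hz ν)]
    simp only [mul_comm (z ν _)]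
    ring

/-- The disc polynomials are positive definite on the sphere. -/
lemma posSemidef_discR {q : ℕ∞} (m n : ℕ) {L : ℕ} (z : Fin L → Ell2) (hz : ∀ μ, z μ ∈ Omega q) :
    (Matrix.of fun μ ν => discR q m n (hdot (z μ) (z ν))).PosSemidef := by
  by_cases hq : q = ⊤ ∨ q ≤ 1
  · have h : (Matrix.of fun μ ν => discR q m n (hdot (z μ) (z ν))) =
        (Matrix.of fun μ ν => hdot (z μ) (z ν) ^ m).hadamard
          (Matrix.of fun μ ν => hdot (z ν) (z μ) ^ n) := by
      ext μ ν
      simp [discR, hq, conj_hdot]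
    rw [h]
    exact (posSemidef_of_pow (posSemidef_hdot z) m).hadamard
      (posSemidef_of_pow (posSemidef_hdot z).transpose n)
  · push Not at hq
    lift q to ℕ using hq.1
    have h2 : 1 < q := by exact_mod_cast hq.2
    obtain ⟨α, rfl⟩ : ∃ α, q = α + 2 := ⟨q - 2, by omega⟩
    rcases le_total n m with h | h
    · obtain ⟨β, rfl⟩ := Nat.exists_eq_add_of_le h
      exact posSemidef_zonal rfl β n z hz
    · obtain ⟨β, rfl⟩ := Nat.exists_eq_add_of_le h
      simp only [discR_swap _ m, conj_hdot]
      exact (posSemidef_zonal rfl β m z hz).transpose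

lemma norm_discR_hdot_le_one {q : ℕ∞} (m n : ℕ) {z w : Ell2} (hz : z ∈ Omega q)
    (hw : w ∈ Omega q) : ‖discR q m n (hdot z w)‖ ≤ 1 := by
  have h := (posSemidef_discR (q := q) m n ![z, w] (by simp [Fin.forall_fin_two, hz, hw])).det_nonneg
  simp only [Matrix.det_fin_two, Matrix.of_apply, Matrix.cons_val_zero, Matrix.cons_val_one,
    hdot_self_of_mem_Omega hz, hdot_self_of_mem_Omega hw, discR_one] at h
  rw [← conj_hdot z w, ← conj_discR, Complex.mul_conj'] at h
  have h' : (0 : ℝ) ≤ 1 - ‖discR q m n (hdot z w)‖ ^ 2 := by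
    rw [one_mul] at h
    exact_mod_cast h
  nlinarith [norm_nonneg (discR q m n (hdot z w))]

open Matrix in
/-- Lemma 3.1 / `lm_Ax_sistBx`: the matrix `A_X` is positive definite
iff the only solution `c` of the system `conj(c)ᵗ B_X^{m,n,k,l} c = 0`, `(m,n,k,l) ∈ J`,
is `c = 0`. -/
theorem stmt9 (q p : ℕ∞) (hq : 1 ≤ q) (hp : 1 ≤ p) (f : ℂ → ℂ → ℂ)
    (hf : ContinuousOn (fun v : ℂ × ℂ => f v.1 v.2) (domD q ×ˢ domD p))
    (hPD : PDonProd q p f)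
    (a : ℕ × ℕ × ℕ × ℕ → ℝ) (ha0 : ∀ i, 0 ≤ a i) (haS : Summable a)
    (hexp : ∀ ξ ∈ domD q, ∀ η ∈ domD p,
      f ξ η = ∑' i : ℕ × ℕ × ℕ × ℕ,
        (a i : ℂ) * discR q i.1 i.2.1 ξ * discR p i.2.2.1 i.2.2.2 η)
    (L : ℕ) (x : Fin L → Ell2 × Ell2)
    (hx : ∀ μ, x μ ∈ (Omega q) ×ˢ (Omega p)) (hinj : Function.Injective x) :
    (Matrix.of fun μ ν : Fin L =>
        f (hdot (x μ).1 (x ν).1) (hdot (x μ).2 (x ν).2)).PosDef ↔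
      ∀ c : Fin L → ℂ,
        (∀ m n k l : ℕ, 0 < a (m, n, k, l) →
          dotProduct (star c)
            ((Matrix.of fun μ ν : Fin L =>
              discR q m n (hdot (x μ).1 (x ν).1) *
                discR p k l (hdot (x μ).2 (x ν).2)) *ᵥ c) = 0) →
        c = 0 := by
  have hterm : ∀ i : ℕ × ℕ × ℕ × ℕ, (Matrix.of fun μ ν : Fin L =>
      discR q i.1 i.2.1 (hdot (x μ).1 (x ν).1) *
        discR p i.2.2.1 i.2.2.2 (hdot (x μ).2 (x ν).2)).PosSemidef := fun i =>
    (posSemidef_discR i.1 i.2.1 (fun μ => (x μ).1) fun μ => (hx μ).1).hadamard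
      (posSemidef_discR i.2.2.1 i.2.2.2 (fun μ => (x μ).2) fun μ => (hx μ).2)
  have hentry : ∀ μ ν, HasSum (fun i : ℕ × ℕ × ℕ × ℕ => (a i : ℂ) *
      (discR q i.1 i.2.1 (hdot (x μ).1 (x ν).1) *
        discR p i.2.2.1 i.2.2.2 (hdot (x μ).2 (x ν).2)))
      (f (hdot (x μ).1 (x ν).1) (hdot (x μ).2 (x ν).2)) := fun μ ν => by
    rw [hexp _ (hdot_mem_domD (hx μ).1 (hx ν).1) _ (hdot_mem_domD (hx μ).2 (hx ν).2)]
    simp only [mul_assoc]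
    refine (Summable.of_norm_bounded haS fun i => ?_).hasSum
    rw [norm_mul, norm_mul, Complex.norm_real, Real.norm_of_nonneg (ha0 i)]
    exact mul_le_of_le_one_right (ha0 i) (mul_le_one₀
      (norm_discR_hdot_le_one _ _ (hx μ).1 (hx ν).1) (norm_nonneg _)
      (norm_discR_hdot_le_one _ _ (hx μ).2 (hx ν).2))
  have hform : ∀ c : Fin L → ℂ, HasSum (fun i : ℕ × ℕ × ℕ × ℕ => (a i : ℂ) *
      (star c ⬝ᵥ ((Matrix.of fun μ ν : Fin L =>
        discR q i.1 i.2.1 (hdot (x μ).1 (x ν).1) *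
          discR p i.2.2.1 i.2.2.2 (hdot (x μ).2 (x ν).2)) *ᵥ c)))
      (star c ⬝ᵥ ((Matrix.of fun μ ν : Fin L =>
        f (hdot (x μ).1 (x ν).1) (hdot (x μ).2 (x ν).2)) *ᵥ c)) := fun c => by
    simp only [dotProduct, mulVec, Matrix.of_apply, Finset.mul_sum]
    refine hasSum_sum fun μ _ => hasSum_sum fun ν _ => ?_
    have h := ((hentry μ ν).mul_right (c ν)).mul_left (star c μ)
    simp only [mul_assoc, mul_left_comm (star c μ) (a _ : ℂ)] at h ⊢
    exact h
  have hnonneg : ∀ (c : Fin L → ℂ) (i : ℕ × ℕ × ℕ × ℕ), 0 ≤ (a i : ℂ) *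
      (star c ⬝ᵥ ((Matrix.of fun μ ν : Fin L =>
        discR q i.1 i.2.1 (hdot (x μ).1 (x ν).1) *
          discR p i.2.2.1 i.2.2.2 (hdot (x μ).2 (x ν).2)) *ᵥ c)) := fun c i =>
    mul_nonneg (Complex.zero_le_real.2 (ha0 i)) ((hterm i).dotProduct_mulVec_nonneg c)
  constructor
  · intro hA c hc
    by_contra hne
    refine (hA.dotProduct_mulVec_pos hne).ne' ((hform c).unique ?_)
    convert hasSum_zero with i
    rcases (ha0 i).eq_or_lt with h | h
    · simp [← h]
    · rw [hc _ _ _ _ h, mul_zero]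
  · intro hc
    refine .of_dotProduct_mulVec_pos ?_ fun c hne => ?_
    · ext μ ν
      refine ((hentry ν μ).star).unique ?_
      rw [Matrix.of_apply]
      convert hentry μ ν using 1
      funext i
      simp [conj_discR, conj_hdot]
    · refine lt_of_le_of_ne ((hform c).nonneg (hnonneg c)) fun h0 => hne (hc c ?_)
      have hs := hform c
      rw [← h0, hasSum_zero_iff_of_nonneg (hnonneg c)] at hs
      intro m n k l hpos
      have := congrFun hs (m, n, k, l)
      exact (mul_eq_zero.1 this).resolve_left (by exact_mod_cast hpos.ne')

end
end

section
/- Let q, p ∈ ℕ ∪ {∞} with q, p ≥ 2 and let f : 𝔻 × 𝔻 → ℂ be a continuous function which is positive definite on Ω_{2q} × Ω_{2p}. Given points w₁,…,w_L ∈ Ω_{2p} and numbers c₁,…,c_L ∈ ℂ, the function F : 𝔻 → ℂ defined by F(ξ) = Σ_{j,k=1}^L f(ξ, w_j·w_k) c_j conj(c_k) is continuous and positive definite on Ω_{2q}. -/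
open scoped ComplexOrder

noncomputable section

/-- The quadratic form of a positive definite kernel is nonnegative on every finite family of
points, repetitions allowed. -/
theorem IsPDKernel.sum_nonneg {α ι : Type*} [Fintype ι] {S : Set α} {K : α → α → ℂ}
    (hK : IsPDKernel S K) (x : ι → α) (hx : ∀ i, x i ∈ S) (c : ι → ℂ) :
    0 ≤ ∑ i, ∑ j, c i * (starRingEnd ℂ) (c j) * K (x i) (x j) := by
  classical
  let T : Finset α := Finset.univ.image x
  let d : α → ℂ := fun t => ∑ i with x i = t, c i
  have hmaps : ∀ i ∈ (Finset.univ : Finset ι), x i ∈ T := fun i hi =>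
    Finset.mem_image_of_mem x hi
  have hfiber : ∀ g : α → ℂ, ∑ i, c i * g (x i) = ∑ t ∈ T, d t * g t := by
    intro g
    rw [← Finset.sum_fiberwise_of_maps_to hmaps]
    refine Finset.sum_congr rfl fun t _ => ?_
    rw [Finset.sum_mul]
    refine Finset.sum_congr rfl fun i hi => ?_
    rw [(Finset.mem_filter.1 hi).2]
  have hfiber_conj : ∀ g : α → ℂ, ∑ i, (starRingEnd ℂ) (c i) * g (x i) =
      ∑ t ∈ T, (starRingEnd ℂ) (d t) * g t := by
    intro g
    simpa using congrArg (starRingEnd ℂ) (hfiber fun t => (starRingEnd ℂ) (g t))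
  have hsum : ∑ i, ∑ j, c i * (starRingEnd ℂ) (c j) * K (x i) (x j) =
      ∑ s ∈ T, ∑ t ∈ T, d s * (starRingEnd ℂ) (d t) * K s t := by
    simp only [mul_assoc, ← Finset.mul_sum]
    simp only [fun s => hfiber_conj (K s)]
    exact hfiber fun s => ∑ t ∈ T, (starRingEnd ℂ) (d t) * K s t
  have hT : ∀ t ∈ T, t ∈ S := by
    intro t ht
    obtain ⟨i, -, rfl⟩ := Finset.mem_image.1 ht
    exact hx i
  let e := T.equivFin
  have h := hK T.card (fun m => (e.symm m : α)) (fun m => hT _ (e.symm m).2)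
    (Subtype.val_injective.comp e.symm.injective) (fun m => d (e.symm m))
  have hreindex : ∀ g : α → ℂ, ∑ m, g (e.symm m) = ∑ t ∈ T, g t := fun g => by
    rw [← Finset.sum_coe_sort T g]
    exact e.symm.sum_comp fun t : T => g t
  rw [hsum, ← hreindex]
  simpa only [← hreindex] using h

theorem norm_hdot_le_one {p : ℕ∞} {z w : Ell2} (hz : z ∈ Omega p) (hw : w ∈ Omega p) :
    ‖hdot z w‖ ≤ 1 := by
  simpa [hdot, hz.1, hw.1] using norm_inner_le_norm (𝕜 := ℂ) w z

/-- Lemma 5.2 / `thm:technical`: if `f` is continuous and PD on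
`Ω_{2q} × Ω_{2p}` (`q, p ≥ 2`), then for points `w₁, …, w_L ∈ Ω_{2p}` and numbers
`c₁, …, c_L ∈ ℂ`, the function `F(ξ) = Σ_{j,k} f(ξ, w_j·w_k) c_j conj(c_k)` is
continuous and PD on `Ω_{2q}`. -/
theorem stmt14 (q p : ℕ∞) (hq : 2 ≤ q) (hp : 2 ≤ p) (f : ℂ → ℂ → ℂ)
    (hf : ContinuousOn (fun v : ℂ × ℂ => f v.1 v.2)
      (Metric.closedBall 0 1 ×ˢ Metric.closedBall 0 1))
    (hPD : PDonProd q p f)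
    (L : ℕ) (w : Fin L → Ell2) (hw : ∀ j, w j ∈ Omega p) (c : Fin L → ℂ) :
    ContinuousOn
      (fun ξ : ℂ => ∑ j, ∑ k, f ξ (hdot (w j) (w k)) * c j * (starRingEnd ℂ) (c k))
      (Metric.closedBall 0 1) ∧
    PDonSphere q
      (fun ξ : ℂ => ∑ j, ∑ k, f ξ (hdot (w j) (w k)) * c j * (starRingEnd ℂ) (c k)) := by
  refine ⟨?_, ?_⟩
  · refine continuousOn_finsetSum _ fun j _ => continuousOn_finsetSum _ fun k _ => ?_
    refine ContinuousOn.mul (ContinuousOn.mul ?_ continuousOn_const) continuousOn_const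
    refine hf.comp (f := fun ξ : ℂ => (ξ, hdot (w j) (w k)))
      (continuousOn_id.prodMk continuousOn_const) fun ξ hξ => ⟨hξ, ?_⟩
    simpa using norm_hdot_le_one (hw j) (hw k)
  · intro M x hx _ b
    have h := IsPDKernel.sum_nonneg hPD (fun i : Fin M × Fin L => (x i.1, w i.2))
      (fun i => ⟨hx i.1, hw i.2⟩) (fun i => b i.1 * c i.2)
    convert h using 1
    simp only [Fintype.sum_prod_type, Finset.mul_sum, map_mul]
    refine Finset.sum_congr rfl fun μ _ => ?_
    rw [Finset.sum_comm]
    refine Finset.sum_congr rfl fun j _ => Finset.sum_congr rfl fun ν _ =>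
      Finset.sum_congr rfl fun k _ => ?_
    ring

end
end
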